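/- If f, g : ℕ → ℂ are bounded functions in A², then the pointwise product fg is in A². -/

import Mathlib

open MeasureTheory Filter Finset
open scoped Classical

/-- `e t = exp(2πit)`. -/
noncomputable def e (t : ℝ) : ℂ := Complex.exp (2 * Real.pi * Complex.I * t)

/-- `N` has (natural) density `ρ`. -/
def HasDensity (N : Set ℕ) (ρ : ℝ) : Prop :=
  Filter.Tendsto (fun x : ℕ => (((Finset.Icc 1 x).filter (fun n => n ∈ N)).card : ℝ) / x)
    Filter.atTop (nhds ρ)

/-- `N` has density `d` in the residue class `a` modulo `q`. -/
def HasResidueDensity (N : Set ℕ) (q a : ℕ) (d : ℝ) : Prop :=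
  Filter.Tendsto (fun x : ℕ =>
      (((Finset.Icc 1 x).filter (fun n => n ∈ N ∧ n % q = a % q)).card : ℝ) / x)
    Filter.atTop (nhds d)

/-- `N` is distributed: all residue class densities exist. -/
def Distributed (N : Set ℕ) : Prop := ∀ q, 1 ≤ q → ∀ a, ∃ d, HasResidueDensity N q a d

/-- The singular series `∑_{q≥1} ∑_{(a,q)=1} |∑_{b=1}^q (F(q,b)/ρ) e(ab/q)|²`. -/
noncomputable def extremalSum (F : ℕ → ℕ → ℝ) (ρ : ℝ) : ℝ :=
  ∑' q : ℕ, ∑ a ∈ (Finset.Icc 1 q).filter (fun a => Nat.Coprime a q),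
    ‖∑ b ∈ Finset.Icc 1 q, ((F q b / ρ : ℝ) : ℂ) * e (((a : ℝ) * b) / q)‖ ^ 2

/-- `N` is extremal. -/
def Extremal (N : Set ℕ) : Prop :=
  ∃ ρ : ℝ, 0 < ρ ∧ HasDensity N ρ ∧
    ∃ F : ℕ → ℕ → ℝ, (∀ q, 1 ≤ q → ∀ a, HasResidueDensity N q a (F q a)) ∧
      1 / ρ = extremalSum F ρ

/-- `S(θ) = ∑_{n ≤ x, n ∈ N} e(θn)`. -/
noncomputable def expSum (N : Set ℕ) (x : ℕ) (θ : ℝ) : ℂ :=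
  ∑ n ∈ (Finset.Icc 1 x).filter (fun n => n ∈ N), e (θ * n)

/-- Rational major arcs `M(x,Q)`. -/
def majorArcs (x Q : ℕ) : Set ℝ :=
  ⋃ q ∈ Finset.Icc 1 Q, ⋃ a ∈ (Finset.Icc 1 q).filter (fun a => Nat.Coprime a q),
    Set.Icc ((a : ℝ) / q - Q / x) ((a : ℝ) / q + Q / x)

/-- Rational minor arcs `m(x,Q) = [0,1] \ M(x,Q)`. -/
def minorArcs (x Q : ℕ) : Set ℝ := Set.Icc 0 1 \ majorArcs x Q

/-- Characteristic function of a set of naturals. -/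
noncomputable def charFun (N : Set ℕ) : ℕ → ℂ := fun n => if n ∈ N then 1 else 0

/-- A (nonconstant-period) periodic function on `ℕ`. -/
def IsPeriodicFn (g : ℕ → ℂ) : Prop := ∃ p : ℕ, 1 ≤ p ∧ ∀ n, g (n + p) = g n

/-- Trigonometric polynomials `n ↦ ∑ a_ν e(α_ν n)`. -/
def IsTrigPoly (g : ℕ → ℂ) : Prop :=
  ∃ (k : ℕ) (a : Fin k → ℂ) (α : Fin k → ℝ), ∀ n : ℕ, g n = ∑ ν : Fin k, a ν * e (α ν * n)

/-- The seminorm `‖f‖₂ = (limsup_x (1/x) ∑_{n≤x} |f n|²)^{1/2}`. -/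
noncomputable def seminorm2 (f : ℕ → ℂ) : ℝ :=
  Real.sqrt (Filter.limsup (fun x : ℕ => (∑ n ∈ Finset.Icc 1 x, ‖f n‖ ^ 2) / x) Filter.atTop)

/-- `f` lies in `A²`, the `‖·‖₂`-closure of the trigonometric polynomials. -/
def MemA2 (f : ℕ → ℂ) : Prop :=
  ∀ ε : ℝ, 0 < ε → ∃ g : ℕ → ℂ, IsTrigPoly g ∧ seminorm2 (fun n => f n - g n) < ε

/-- `f` lies in `B²`, the `‖·‖₂`-closure of the periodic functions. -/
def MemB2 (f : ℕ → ℂ) : Prop :=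
  ∀ ε : ℝ, 0 < ε → ∃ g : ℕ → ℂ, IsPeriodicFn g ∧ seminorm2 (fun n => f n - g n) < ε

/-- `f` is `B²`-almost periodic: there is a sequence of periodic functions `fq` with
`limsup_x (1/x) ∑_{n≤x} |f n - fq n|² → 0`. -/
def B2AlmostPeriodic (f : ℕ → ℂ) : Prop :=
  ∃ fq : ℕ → ℕ → ℂ, (∀ q, IsPeriodicFn (fq q)) ∧
    Filter.Tendsto (fun q : ℕ =>
        Filter.limsup (fun x : ℕ => (∑ n ∈ Finset.Icc 1 x, ‖f n - fq q n‖ ^ 2) / x)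
          Filter.atTop)
      Filter.atTop (nhds 0)

/-- The Fourier coefficient `⟨f, e_β⟩ = lim_x (1/x) ∑_{n≤x} f n e(-βn)` equals `c`. -/
def HasFourierCoeff (f : ℕ → ℂ) (β : ℝ) (c : ℂ) : Prop :=
  Filter.Tendsto (fun x : ℕ => (∑ n ∈ Finset.Icc 1 x, f n * e (-(β * n))) / (x : ℂ))
    Filter.atTop (nhds c)

/-- The spectrum of `f`: those `β` with nonzero Fourier coefficient. -/
def spec (f : ℕ → ℂ) : Set ℝ := {β | ∃ c : ℂ, c ≠ 0 ∧ HasFourierCoeff f β c}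

/-- Major arcs `M_α(x,Q)` relative to a sequence `α`. -/
def majorArcsAlpha (α : ℕ → ℝ) (x Q : ℕ) : Set ℝ :=
  ⋃ n : ℕ, ⋃ _ : n ≤ Q, Set.Icc (α n - Q / x) (α n + Q / x)

/-- Minor arcs `m_α(x,Q) = [0,1] \ M_α(x,Q)`. -/
def minorArcsAlpha (α : ℕ → ℝ) (x Q : ℕ) : Set ℝ := Set.Icc 0 1 \ majorArcsAlpha α x Q

/-- `N` is `α`-extremal: it has positive density, all Fourier coefficients of its
characteristic function exist, and `∫_{m_α(x,Q(x))} |S|² = o(x)` for every `Q(x) → ∞`. -/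
def AlphaExtremal (N : Set ℕ) (α : ℕ → ℝ) : Prop :=
  (∃ ρ : ℝ, 0 < ρ ∧ HasDensity N ρ) ∧
  (∀ β : ℝ, ∃ c : ℂ, HasFourierCoeff (charFun N) β c) ∧
  ∀ Q : ℕ → ℕ, Filter.Tendsto Q Filter.atTop Filter.atTop →
    Filter.Tendsto (fun x : ℕ =>
        (∫ θ in minorArcsAlpha α x (Q x), ‖expSum N x θ‖ ^ 2) / x)
      Filter.atTop (nhds 0)

theorem norm_e (t : ℝ) : ‖e t‖ = 1 := by
  have h : (2 * Real.pi * Complex.I * t : ℂ) = ((2 * Real.pi * t : ℝ) : ℂ) * Complex.I := by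
    push_cast; ring
  rw [e, h, Complex.norm_exp_ofReal_mul_I]

theorem e_add (s t : ℝ) : e (s + t) = e s * e t := by
  rw [e, e, e, ← Complex.exp_add]
  congr 1
  push_cast
  ring

theorem IsTrigPoly.exists_norm_le {p : ℕ → ℂ} (hp : IsTrigPoly p) :
    ∃ C : ℝ, ∀ n, ‖p n‖ ≤ C := by
  obtain ⟨k, a, α, h⟩ := hp
  refine ⟨∑ ν, ‖a ν‖, fun n => ?_⟩
  rw [h n]
  refine (norm_sum_le _ _).trans (Finset.sum_le_sum fun ν _ => ?_)
  rw [norm_mul, norm_e, mul_one]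

theorem IsTrigPoly.mul {p q : ℕ → ℂ} (hp : IsTrigPoly p) (hq : IsTrigPoly q) :
    IsTrigPoly fun n => p n * q n := by
  obtain ⟨k, a, α, hp⟩ := hp
  obtain ⟨l, b, β, hq⟩ := hq
  refine ⟨k * l, fun i => a (finProdFinEquiv.symm i).1 * b (finProdFinEquiv.symm i).2,
    fun i => α (finProdFinEquiv.symm i).1 + β (finProdFinEquiv.symm i).2, fun n => ?_⟩
  beta_reduce
  rw [finProdFinEquiv.symm.sum_comp
    (fun x : Fin k × Fin l => a x.1 * b x.2 * e ((α x.1 + β x.2) * n)), hp, hq,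
    Finset.sum_mul_sum, Fintype.sum_prod_type]
  refine Finset.sum_congr rfl fun i _ => Finset.sum_congr rfl fun j _ => ?_
  rw [add_mul, e_add]
  ring

theorem mean_sq_le_of_norm_le {f : ℕ → ℂ} {C : ℝ} (hf : ∀ n, ‖f n‖ ≤ C) (x : ℕ) :
    (∑ n ∈ Finset.Icc 1 x, ‖f n‖ ^ 2) / x ≤ C ^ 2 := by
  refine div_le_of_le_mul₀ (Nat.cast_nonneg x) (sq_nonneg C) ?_
  calc ∑ n ∈ Finset.Icc 1 x, ‖f n‖ ^ 2 ≤ ∑ _n ∈ Finset.Icc 1 x, C ^ 2 :=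
        Finset.sum_le_sum fun n _ => pow_le_pow_left₀ (norm_nonneg _) (hf n) 2
    _ = C ^ 2 * x := by simp [mul_comm]

theorem eventually_mean_sq_lt {f : ℕ → ℂ} {C ε : ℝ} (hf : ∀ n, ‖f n‖ ≤ C) (hε : 0 < ε)
    (h : seminorm2 f < ε) :
    ∀ᶠ x : ℕ in Filter.atTop, (∑ n ∈ Finset.Icc 1 x, ‖f n‖ ^ 2) / x < ε ^ 2 :=
  Filter.eventually_lt_of_limsup_lt ((Real.sqrt_lt' hε).1 h)
    (Filter.isBoundedUnder_of ⟨C ^ 2, mean_sq_le_of_norm_le hf⟩)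

theorem seminorm2_lt_of_eventually_mean_sq_le {f : ℕ → ℂ} {δ ε : ℝ} (hε : 0 < ε)
    (hδ : δ < ε ^ 2)
    (h : ∀ᶠ x : ℕ in Filter.atTop, (∑ n ∈ Finset.Icc 1 x, ‖f n‖ ^ 2) / x ≤ δ) :
    seminorm2 f < ε := by
  refine (Real.sqrt_lt' hε).2 (lt_of_le_of_lt (Filter.limsup_le_of_le ?_ h) hδ)
  exact Filter.IsCoboundedUnder.of_frequently_ge (a := 0)
    (Filter.Frequently.of_forall fun x => by positivity)

theorem norm_mul_sub_mul_sq_le {C D : ℝ} {a b p q : ℂ} (ha : ‖a‖ ≤ C) (hq : ‖q‖ ≤ D) :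
    ‖a * b - p * q‖ ^ 2 ≤ 2 * C ^ 2 * ‖b - q‖ ^ 2 + 2 * D ^ 2 * ‖a - p‖ ^ 2 := by
  have h : ‖a * b - p * q‖ ≤ C * ‖b - q‖ + D * ‖a - p‖ := by
    calc ‖a * b - p * q‖ = ‖a * (b - q) + q * (a - p)‖ := by congr 1; ring
      _ ≤ ‖a‖ * ‖b - q‖ + ‖q‖ * ‖a - p‖ := by
        simpa only [norm_mul] using norm_add_le (a * (b - q)) (q * (a - p))
      _ ≤ C * ‖b - q‖ + D * ‖a - p‖ := by gcongr
  calc ‖a * b - p * q‖ ^ 2 ≤ (C * ‖b - q‖ + D * ‖a - p‖) ^ 2 :=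
        pow_le_pow_left₀ (norm_nonneg _) h 2
    _ ≤ 2 * C ^ 2 * ‖b - q‖ ^ 2 + 2 * D ^ 2 * ‖a - p‖ ^ 2 := by
        nlinarith [sq_nonneg (C * ‖b - q‖ - D * ‖a - p‖)]

theorem exists_norm_sub_le {f p : ℕ → ℂ} (hf : ∃ C : ℝ, ∀ n, ‖f n‖ ≤ C)
    (hp : ∃ C : ℝ, ∀ n, ‖p n‖ ≤ C) : ∃ C : ℝ, ∀ n, ‖f n - p n‖ ≤ C := by
  obtain ⟨C, hC⟩ := hf
  obtain ⟨D, hD⟩ := hp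
  exact ⟨C + D, fun n => (norm_sub_le _ _).trans (add_le_add (hC n) (hD n))⟩

/-- the product of bounded functions in `A²` is in `A²`. -/
theorem stmt_9 (f g : ℕ → ℂ) (hfb : ∃ C : ℝ, ∀ n, ‖f n‖ ≤ C) (hgb : ∃ C : ℝ, ∀ n, ‖g n‖ ≤ C)
    (hf : MemA2 f) (hg : MemA2 g) :
    MemA2 (fun n => f n * g n) := by
  intro ε hε
  obtain ⟨C, hC⟩ := hfb
  have hC₀ : 0 ≤ C := (norm_nonneg _).trans (hC 0)
  obtain ⟨q, hq, hgq⟩ := hg (ε / (3 * (C + 1))) (by positivity)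
  obtain ⟨D, hD⟩ := hq.exists_norm_le
  have hD₀ : 0 ≤ D := (norm_nonneg _).trans (hD 0)
  obtain ⟨p, hp, hfp⟩ := hf (ε / (3 * (D + 1))) (by positivity)
  obtain ⟨B₁, hB₁⟩ := exists_norm_sub_le hgb hq.exists_norm_le
  obtain ⟨B₂, hB₂⟩ := exists_norm_sub_le ⟨C, hC⟩ hp.exists_norm_le
  have key : ∀ K : ℝ, 0 ≤ K → 2 * K ^ 2 * (ε / (3 * (K + 1))) ^ 2 ≤ 2 * (ε / 3) ^ 2 := by
    intro K hK
    have h : K * (ε / (3 * (K + 1))) ≤ ε / 3 := by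
      rw [mul_div_assoc', div_le_div_iff₀ (by positivity) (by norm_num)]
      nlinarith
    have := pow_le_pow_left₀ (by positivity) h 2
    rw [mul_pow] at this
    linarith
  refine ⟨fun n => p n * q n, hp.mul hq,
    seminorm2_lt_of_eventually_mean_sq_le (δ := 4 * (ε / 3) ^ 2) hε (by nlinarith) ?_⟩
  filter_upwards [eventually_mean_sq_lt hB₁ (by positivity) hgq,
    eventually_mean_sq_lt hB₂ (by positivity) hfp] with x h₁ h₂
  calc (∑ n ∈ Finset.Icc 1 x, ‖f n * g n - p n * q n‖ ^ 2) / (x : ℝ)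
      ≤ (∑ n ∈ Finset.Icc 1 x,
          (2 * C ^ 2 * ‖g n - q n‖ ^ 2 + 2 * D ^ 2 * ‖f n - p n‖ ^ 2)) / (x : ℝ) := by
        gcongr with n _
        exact norm_mul_sub_mul_sq_le (hC n) (hD n)
    _ = 2 * C ^ 2 * ((∑ n ∈ Finset.Icc 1 x, ‖g n - q n‖ ^ 2) / x)
          + 2 * D ^ 2 * ((∑ n ∈ Finset.Icc 1 x, ‖f n - p n‖ ^ 2) / x) := by
        rw [Finset.sum_add_distrib, ← Finset.mul_sum, ← Finset.mul_sum]
        ring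
    _ ≤ 2 * C ^ 2 * (ε / (3 * (C + 1))) ^ 2 + 2 * D ^ 2 * (ε / (3 * (D + 1))) ^ 2 := by
        gcongr
    _ ≤ 4 * (ε / 3) ^ 2 := by linarith [key C hC₀, key D hD₀]
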